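/- For every G-set Γ, the monoid S(Γ) is saturated in the lattice M = { u ∈ ℤ³ : wt(u) = 0 }: for every u ∈ M and every integer n ≥ 1, if n·u ∈ S(Γ) then u ∈ S(Γ). -/

import Mathlib

open scoped BigOperators Classical

namespace GH

/-- Exponent vectors of monomials `x^m y^n z^p`. -/
abbrev N3 : Type := ℕ × ℕ × ℕ

/-- The lattice `ℤ³`. -/
abbrev Z3 : Type := ℤ × ℤ × ℤ

/-- Inclusion `ℕ³ → ℤ³`. -/
def toZ (v : N3) : Z3 := ((v.1 : ℤ), (v.2.1 : ℤ), (v.2.2 : ℤ))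

/-- The weight map `wt(m,n,p) = m + a·n + (r−a)·p (mod r)` on `ℤ³`. -/
def wtZ (r a : ℕ) (v : Z3) : ZMod r :=
  (v.1 : ZMod r) + (a : ZMod r) * (v.2.1 : ZMod r) + ((r - a : ℕ) : ZMod r) * (v.2.2 : ZMod r)

/-- The weight map on `ℕ³`. -/
def wtN (r a : ℕ) (v : N3) : ZMod r := wtZ r a (toZ v)

/-- A `G`-set: contains the origin, closed under taking summands, and the weight map
restricted to it is a bijection onto `ℤ/rℤ`. -/
structure IsGSet (r a : ℕ) (Γ : Set N3) : Prop where
  zero_mem : (0, 0, 0) ∈ Γ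
  dclosed : ∀ u v : N3, u + v ∈ Γ → u ∈ Γ ∧ v ∈ Γ
  bij : Set.BijOn (wtN r a) Γ Set.univ

/-- `wt_Γ(v)`: the (unique, for a `G`-set) element of `Γ` of the same weight as `v`. -/
noncomputable def wtG (r a : ℕ) (Γ : Set N3) (v : N3) : N3 :=
  if h : ∃ w, w ∈ Γ ∧ wtN r a w = wtN r a v then h.choose else (0, 0, 0)

/-- `(m,n)` is a y-valley of `Γ`. -/
def IsYValley (Γ : Set N3) (m n : ℕ) : Prop :=
  (m, n, 0) ∈ Γ ∧ (m + 1, n, 0) ∈ Γ ∧ (m, n + 1, 0) ∈ Γ ∧ (m + 1, n + 1, 0) ∉ Γ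

/-- `(m,n)` is a z-valley of `Γ`. -/
def IsZValley (Γ : Set N3) (m n : ℕ) : Prop :=
  (m, 0, n) ∈ Γ ∧ (m + 1, 0, n) ∈ Γ ∧ (m, 0, n + 1) ∈ Γ ∧ (m + 1, 0, n + 1) ∉ Γ

/-- A primitive `G`-set: it has a y-valley `(i_y, 0)` and a z-valley `(i_z, 0)`. -/
def IsPrimG (Γ : Set N3) : Prop := (∃ p : ℕ, IsYValley Γ p 0) ∧ (∃ p : ℕ, IsZValley Γ p 0)

/-- `s_Γ(v) = v − wt_Γ(v) ∈ ℤ³`. -/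
noncomputable def sG (r a : ℕ) (Γ : Set N3) (v : N3) : Z3 := toZ v - toZ (wtG r a Γ v)

/-- The submonoid `S(Γ)` of `ℤ³` generated by all `s_Γ(v)`. -/
noncomputable def SMon (r a : ℕ) (Γ : Set N3) : AddSubmonoid Z3 :=
  AddSubmonoid.closure (Set.range (sG r a Γ))

/-- The lattice `M = { u ∈ ℤ³ : wt(u) = 0 }` of `G`-invariant monomials. -/
def latM (r a : ℕ) : Set Z3 := { u | wtZ r a u = 0 }

/-- The standard pairing of `ℝ³` with `ℤ³`. -/
def dotR (α : ℝ × ℝ × ℝ) (u : Z3) : ℝ :=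
  α.1 * (u.1 : ℝ) + α.2.1 * (u.2.1 : ℝ) + α.2.2 * (u.2.2 : ℝ)

/-- The cone `σ(Γ) = { α ∈ ℝ³ : ⟨α, s_Γ(v)⟩ ≥ 0 for all v ∈ ℕ³ }`. -/
noncomputable def sigmaCone (r a : ℕ) (Γ : Set N3) : Set (ℝ × ℝ × ℝ) :=
  { α | ∀ v : N3, 0 ≤ dotR α (sG r a Γ v) }

/-- `span(u₁,…,u_t)`: all `v ∈ ℕ³` dominated componentwise by some `u_s`. -/
def spanSet (s : Set N3) : Set N3 := { v | ∃ u ∈ s, v ≤ u }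

/-- `i(Γ)`: the largest `m` with `(m,0,0) ∈ Γ`. -/
noncomputable def iOf (Γ : Set N3) : ℕ := sSup { m : ℕ | (m, 0, 0) ∈ Γ }

/-- `j(Γ)`: the largest `n` with `(0,n,0) ∈ Γ`. -/
noncomputable def jOf (Γ : Set N3) : ℕ := sSup { n : ℕ | (0, n, 0) ∈ Γ }

/-- `k(Γ)`: the largest `p` with `(0,0,p) ∈ Γ`. -/
noncomputable def kOf (Γ : Set N3) : ℕ := sSup { p : ℕ | (0, 0, p) ∈ Γ }

/-- `c(w) = max { c : w − c·v ∈ ℕ³ }` (componentwise). -/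
noncomputable def cmax (v w : N3) : ℕ := sSup { c : ℕ | c • v ≤ w }

/-- The `G`-igsaw transformation of `Γ` in the direction of `u`:
`T_u(Γ) = { w + c(w)·(u − v) : w ∈ Γ }` where `v = wt_Γ(u)`. -/
noncomputable def jig (r a : ℕ) (Γ : Set N3) (u : N3) : Set N3 :=
  { w' | ∃ w ∈ Γ,
      toZ w' = toZ w + (cmax (wtG r a Γ u) w) • (toZ u - toZ (wtG r a Γ u)) }

/-- The upper transformation `TU(Γ)`. -/
noncomputable def TU (r a : ℕ) (Γ : Set N3) : Set N3 := jig r a Γ (iOf Γ + 1, 0, 0)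

/-- The right transformation `TR(Γ)`. -/
noncomputable def TR (r a : ℕ) (Γ : Set N3) : Set N3 := jig r a Γ (0, jOf Γ + 1, 0)

/-- The left transformation `TL(Γ)`. -/
noncomputable def TL (r a : ℕ) (Γ : Set N3) : Set N3 := jig r a Γ (0, 0, kOf Γ + 1)

/-- The y-valley of `Γ` (chosen by choice; unique for a `G`-set having one). -/
noncomputable def yValley (Γ : Set N3) : ℕ × ℕ :=
  if h : ∃ p : ℕ × ℕ, IsYValley Γ p.1 p.2 then h.choose else (0, 0)

/-- The z-valley of `Γ` (chosen by choice; unique for a `G`-set having one). -/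
noncomputable def zValley (Γ : Set N3) : ℕ × ℕ :=
  if h : ∃ p : ℕ × ℕ, IsZValley Γ p.1 p.2 then h.choose else (0, 0)

/-- The upper right transformation `TUR(Γ)`, in the direction `(i_y+1, j_y+1, 0)`. -/
noncomputable def TUR (r a : ℕ) (Γ : Set N3) : Set N3 :=
  jig r a Γ ((yValley Γ).1 + 1, (yValley Γ).2 + 1, 0)

/-- The upper left transformation `TUL(Γ)`, in the direction `(i_z+1, 0, k_z+1)`. -/
noncomputable def TUL (r a : ℕ) (Γ : Set N3) : Set N3 :=
  jig r a Γ ((zValley Γ).1 + 1, 0, (zValley Γ).2 + 1)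

/-- The bound `min{j, k, j − j_y, k − k_z}` for the triangle of transformations. -/
noncomputable def minBound (Γ : Set N3) : ℕ :=
  min (min (jOf Γ) (kOf Γ)) (min (jOf Γ - (yValley Γ).2) (kOf Γ - (zValley Γ).2))

/-- The triangle of transformations `Θ(Γ)`. -/
noncomputable def Theta (r a : ℕ) (Γ : Set N3) : Set (Set N3) :=
  { Γ' | ∃ p q : ℕ, p + q ≤ minBound Γ ∧ Γ' = (TUR r a)^[p] ((TUL r a)^[q] Γ) }

/-- The recursion step producing `Γ_{n+1}` from `Γ_n`. -/
noncomputable def nextGamma (r a : ℕ) (Γ : Set N3) : Set N3 :=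
  if jOf Γ < kOf Γ then TU r a ((TUR r a)^[jOf Γ] Γ)
  else TU r a ((TUL r a)^[kOf Γ] Γ)

/-- The sequence of primitive `G`-sets; `GammaSeq r a b (n-1)` is `Γ_n`,
starting from `Γ₁ = span((1,0,0),(0,b−1,0),(0,0,r−b−1))`. -/
noncomputable def GammaSeq (r a b : ℕ) : ℕ → Set N3
  | 0 => spanSet {(1, 0, 0), (0, b - 1, 0), (0, 0, r - b - 1)}
  | n + 1 => nextGamma r a (GammaSeq r a b n)


/-- A planar model of a `G`-set: the point `(m, n)` stands for `x^m y^n` or `x^m z^(-n)`, and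
`K` is the lattice of planar vectors of weight zero. -/
structure IsTile (r : ℤ) (E K : ℤ → ℤ → Prop) : Prop where
  pos : 0 < r
  zero : E 0 0
  nonneg : ∀ {m n}, E m n → 0 ≤ m
  down : ∀ {m n m' n'}, E m n → 0 ≤ m' → m' ≤ m →
    (0 ≤ n' ∧ n' ≤ n ∨ n ≤ n' ∧ n' ≤ 0) → E m' n'
  inj : ∀ {m n m' n'}, E m n → E m' n' → K (m - m') (n - n') → m = m' ∧ n = n'
  surj : ∀ m n, ∃ m' n', E m' n' ∧ K (m - m') (n - n')
  add : ∀ {x y x' y'}, K x y → K x' y' → K (x + x') (y + y')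
  neg : ∀ {x y}, K x y → K (-x) (-y)
  left : K r 0
  right : K 0 r

theorem IsTile.swap {r : ℤ} {E K : ℤ → ℤ → Prop} (h : IsTile r E K) :
    IsTile r (fun m n => E m (-n)) (fun x y => K x (-y)) where
  pos := h.pos
  zero := by simpa using h.zero
  nonneg := h.nonneg
  down := fun hE h0 h1 h2 => h.down hE h0 h1 (by omega)
  inj := fun {m n m' n'} h1 h2 h3 => by
    have := h.inj h1 h2 (by convert h3 using 1; ring)
    omega
  surj := fun m n => by
    obtain ⟨m', n', h1, h2⟩ := h.surj m (-n)
    exact ⟨m', -n', by simpa using h1, by convert h2 using 1; ring⟩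
  add := fun h1 h2 => by convert h.add h1 h2 using 1; ring
  neg := fun h1 => h.neg h1
  left := by simpa using h.left
  right := by simpa using h.neg h.right

/-- The ends of the three axes of a tile, and the representatives of the points
following them. -/
structure IsCorner (E K : ℤ → ℤ → Prop) (i j k nx my ny mz nz : ℤ) : Prop where
  i_nonneg : 0 ≤ i
  j_nonneg : 0 ≤ j
  k_nonneg : 0 ≤ k
  mem_i : E i 0
  notMem_i : ¬ E (i + 1) 0
  mem_j : E 0 j
  notMem_j : ¬ E 0 (j + 1)
  mem_k : E 0 (-k)
  notMem_k : ¬ E 0 (-k - 1)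
  mem_x : E 0 nx
  mem_y : E my ny
  mem_z : E mz nz
  rel_x : K (i + 1) (-nx)
  rel_y : K (-my) (j + 1 - ny)
  rel_z : K (-mz) (-k - 1 - nz)

theorem IsCorner.swap {E K : ℤ → ℤ → Prop} {i j k nx my ny mz nz : ℤ}
    (c : IsCorner E K i j k nx my ny mz nz) :
    IsCorner (fun m n => E m (-n)) (fun x y => K x (-y)) i k j (-nx) mz (-nz) my (-ny) where
  i_nonneg := c.i_nonneg
  j_nonneg := c.k_nonneg
  k_nonneg := c.j_nonneg
  mem_i := by simpa using c.mem_i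
  notMem_i := by simpa using c.notMem_i
  mem_j := c.mem_k
  notMem_j := by convert c.notMem_k using 2; ring
  mem_k := by simpa using c.mem_j
  notMem_k := by convert c.notMem_j using 2; ring
  mem_x := by simpa using c.mem_x
  mem_y := by simpa using c.mem_z
  mem_z := by simpa using c.mem_y
  rel_x := by simpa using c.rel_x
  rel_y := by convert c.rel_z using 1; ring
  rel_z := by convert c.rel_y using 1; ring

theorem exists_last {P : ℤ → Prop} {N : ℤ} (h0 : P 0) (hN : 0 ≤ N) (hP : ¬ P N) :
    ∃ j, 0 ≤ j ∧ j < N ∧ P j ∧ ¬ P (j + 1) := by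
  by_contra! H
  have key : ∀ t : ℤ, 0 ≤ t → t ≤ N → P t := by
    intro t ht
    induction t, ht using Int.leInduction with
    | base => exact fun _ => h0
    | succ t ht ih => exact fun h => H t ht (by omega) (ih (by omega))
  exact hP (key N hN le_rfl)

namespace IsTile

variable {r : ℤ} {E K : ℤ → ℤ → Prop}

theorem eq_of_rel (h : IsTile r E K) {m n m' n' x y : ℤ} (h1 : E m n) (h2 : E m' n')
    (hK : K x y) (hx : x = m - m') (hy : y = n - n') : m = m' ∧ n = n' :=
  h.inj h1 h2 (by rwa [← hx, ← hy])

theorem sub (h : IsTile r E K) {x y x' y' : ℤ} (h1 : K x y) (h2 : K x' y') :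
    K (x - x') (y - y') := by
  simpa [sub_eq_add_neg] using h.add h1 (h.neg h2)

/-- The point following the upper end of a row or column has its representative at the lower end
of a row or column. -/
theorem notMem_pred_right (h : IsTile r E K) {m n m' n' : ℤ} (h1 : E m n) (h2 : ¬ E m (n + 1))
    (h3 : E m' n') (hK : K (m - m') (n + 1 - n')) : ¬ E m' (n' - 1) := by
  intro h4
  obtain ⟨rfl, h6⟩ := h.eq_of_rel h1 h4 hK rfl (by ring)
  obtain rfl : n' = n + 1 := by omega
  exact h2 h3

theorem nonpos_of_right (h : IsTile r E K) {m n m' n' : ℤ} (h1 : E m n) (h2 : ¬ E m (n + 1))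
    (h3 : E m' n') (hK : K (m - m') (n + 1 - n')) : n' ≤ 0 := by
  by_contra! hn
  exact h.notMem_pred_right h1 h2 h3 hK (h.down h3 (h.nonneg h3) le_rfl (by omega))

theorem eq_left_end (h : IsTile r E K) {k n : ℤ} (hk0 : 0 ≤ k) (hk : E 0 (-k))
    (hk' : ¬ E 0 (-k - 1)) (hn : n ≤ 0) (h1 : E 0 n) (h2 : ¬ E 0 (n - 1)) : n = -k := by
  have h3 : -k ≤ n := by
    by_contra! h3
    exact hk' (h.down h1 le_rfl le_rfl (by omega))
  by_contra h4
  exact h2 (h.down hk le_rfl le_rfl (by omega))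

theorem exists_corner (h : IsTile r E K) :
    ∃ i j k nx my ny mz nz : ℤ, IsCorner E K i j k nx my ny mz nz := by
  have hr := h.pos
  have bi : ¬ E r 0 := fun H => by
    have := h.eq_of_rel H h.zero h.left (by ring) (by ring); omega
  have bj : ¬ E 0 r := fun H => by
    have := h.eq_of_rel H h.zero h.right (by ring) (by ring); omega
  have bk : ¬ E 0 (-r) := fun H => by
    have := h.eq_of_rel h.zero H h.right (by ring) (by ring); omega
  obtain ⟨i, hi0, -, hi, hi'⟩ := exists_last (P := fun t => E t 0) h.zero hr.le bi
  obtain ⟨j, hj0, -, hj, hj'⟩ := exists_last (P := fun t => E 0 t) h.zero hr.le bj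
  obtain ⟨k, hk0, -, hk, hk'⟩ := exists_last (P := fun t => E 0 (-t)) (by simpa using h.zero)
    hr.le bk
  obtain ⟨mx, nx, hx, hKx⟩ := h.surj (i + 1) 0
  obtain ⟨my, ny, hy, hKy⟩ := h.surj 0 (j + 1)
  obtain ⟨mz, nz, hz, hKz⟩ := h.surj 0 (-k - 1)
  have hmx : mx = 0 := by
    by_contra h0
    have := h.nonneg hx
    obtain ⟨h1, h2⟩ := h.eq_of_rel hi (h.down (n' := nx) hx (m' := mx - 1) (by omega) (by omega)
      (by omega)) hKx (by ring) rfl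
    subst h2
    exact hi' (by convert hx using 1; omega)
  subst hmx
  exact ⟨i, j, k, nx, my, ny, mz, nz, hi0, hj0, hk0, hi, hi', hj, hj', hk,
    by convert hk' using 2; ring, hx, hy, hz, by simpa using hKx, by simpa using hKy,
    by simpa using hKz⟩

section corner

variable {i j k nx my ny mz nz : ℤ}

theorem ny_nonpos (h : IsTile r E K) (c : IsCorner E K i j k nx my ny mz nz) : ny ≤ 0 :=
  h.nonpos_of_right c.mem_j c.notMem_j c.mem_y (by simpa using c.rel_y)

theorem nz_nonneg (h : IsTile r E K) (c : IsCorner E K i j k nx my ny mz nz) : 0 ≤ nz := by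
  have := h.swap.ny_nonpos c.swap
  omega

/-- The two possible jumps at the right end of a row. -/
theorem right_jump (h : IsTile r E K) (c : IsCorner E K i j k nx my ny mz nz) {m n m' n' : ℤ}
    (hn : 0 ≤ n) (h1 : E m n) (h2 : ¬ E m (n + 1)) (h3 : E m' n')
    (hK : K (m - m') (n + 1 - n')) :
    (m - m' = -my ∧ n = j ∧ n' = ny) ∨
      (m - m' = mz ∧ n = nz ∧ n' = -k) := by
  have hm := h.nonneg h1
  induction m, hm using Int.leInduction generalizing m' with
  | base =>
    have hj : n = j := by
      have := h.swap.eq_left_end c.j_nonneg (n := -n) (by simpa using c.mem_j)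
        (by convert c.notMem_j using 2; ring) (by omega) (by simpa using h1)
        (by convert h2 using 2; ring)
      omega
    subst hj
    obtain ⟨e1, e2⟩ := h.eq_of_rel c.mem_y h3 (h.sub hK c.rel_y) (by ring) (by ring)
    left; omega
  | succ m hm ih =>
    have hn' := h.nonpos_of_right h1 h2 h3 hK
    rcases (h.nonneg h3).eq_or_lt with h0 | h0
    · subst h0
      have e := h.eq_left_end c.k_nonneg c.mem_k c.notMem_k hn' h3
        (h.notMem_pred_right h1 h2 h3 hK)
      subst e
      obtain ⟨e1, e2⟩ := h.eq_of_rel h1 c.mem_z (h.add hK c.rel_z) (by ring) (by ring)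
      right; omega
    · have h4 : E (m' - 1) n' := h.down h3 (by omega) (by omega) (by omega)
      have hK' : K (m - (m' - 1)) (n + 1 - n') := by convert hK using 1; ring
      have := ih (h.down h1 hm (by omega) (by omega)) (fun h5 => by
        obtain ⟨e1, e2⟩ := h.inj h5 h4 hK'
        subst e2
        exact h2 (by convert h3 using 1; omega)) h4 hK'
      omega

/-- A tile without a descent on its right side. -/
theorem no_right_valley (h : IsTile r E K) (c : IsCorner E K i j k nx my ny mz nz)
    (hv : ∀ m n, 0 ≤ n → E (m + 1) n → E m (n + 1) → E (m + 1) (n + 1)) :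
    (my + mz = 0 ∧ j = nz ∧ k = -ny) ∨
      (i + 1 = my + mz ∧ j = nz + max nx 0 ∧ k = -ny + max (-nx) 0) := by
  have hrow : ∀ m, 0 ≤ m → E m 0 → ∀ n, 0 ≤ n → n ≤ j → E m n := by
    intro m hm
    induction m, hm using Int.leInduction with
    | base => exact fun _ n h0 h1 => h.down c.mem_j le_rfl le_rfl (by omega)
    | succ m hm ih =>
      intro h0 n hn
      induction n, hn using Int.leInduction with
      | base => exact fun _ => h0
      | succ n hn ihn =>
        exact fun hj => hv m n hn (ihn (by omega))
          (ih (h.down h0 hm (by omega) (by omega)) _ (by omega) hj)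
  have hnz := h.nz_nonneg c
  have hny := h.ny_nonpos c
  have hmz := h.nonneg c.mem_z
  have hmy := h.nonneg c.mem_y
  have hzj : nz = j := by
    have h1 : ¬ E mz (nz + 1) := by
      have := h.swap.notMem_pred_right c.swap.mem_j c.swap.notMem_j c.swap.mem_y
        (by simpa using c.swap.rel_y)
      convert this using 2; ring
    have h2 : nz ≤ j := by
      by_contra! h3
      exact c.notMem_j (h.down c.mem_z le_rfl hmz (by have := c.j_nonneg; omega))
    by_contra h3
    exact h1 (hrow mz hmz (h.down c.mem_z hmz le_rfl (by omega)) _ (by omega) (by omega))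
  subst hzj
  have hrel : K mz (nz + 1 + k) := by convert h.neg c.rel_z using 1 <;> ring
  rcases hmz.eq_or_lt with h0 | h0
  · subst h0
    obtain ⟨e1, e2⟩ := h.eq_of_rel c.mem_y c.mem_k (h.sub hrel c.rel_y) (by ring) (by ring)
    left; omega
  · obtain ⟨m', n', h3, hK⟩ := h.surj (mz - 1) (nz + 1)
    have h1 : E (mz - 1) nz := h.down c.mem_z (by omega) (by omega) (by omega)
    have h2 : ¬ E (mz - 1) (nz + 1) := fun H =>
      c.notMem_j (h.down H le_rfl (by omega) (by omega))
    have hm' := h.nonneg h3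
    rcases h.right_jump c hnz h1 h2 h3 hK with ⟨e1, -, rfl⟩ | ⟨e1, -, -⟩
    swap; · omega
    have hK2 : K (m' + 1) (n' + k) := by
      convert h.sub hrel hK using 1 <;> ring
    have h4 : ¬ E (m' + 1) n' := fun H => by
      have := h.eq_of_rel H c.mem_k hK2 (by ring) (by ring); omega
    have hk : -k ≤ n' := by
      by_contra! H
      exact c.notMem_k (h.down h3 le_rfl hm' (by have := c.k_nonneg; omega))
    have h5 : ¬ E (m' + 1) 0 := by
      intro H
      obtain ⟨t, ht0, htn, h6, h7⟩ := exists_last (P := fun t => E (m' + 1) (-t)) (N := -n')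
        (by simpa using H) (by omega) (by simpa using h4)
      obtain ⟨m2, n2, h8, hK3⟩ := h.surj (m' + 1) (-(t + 1))
      have h9 : m2 = 0 := by
        by_contra h10
        have := h.nonneg h8
        obtain ⟨e2, e3⟩ := h.eq_of_rel (h.down (n' := -(t + 1)) h3 (m' := m') (by omega) le_rfl
            (by omega))
          (h.down (n' := n2) h8 (m' := m2 - 1) (by omega) (by omega) (by omega)) hK3
          (by ring) rfl
        subst e3
        exact h7 (by convert h8 using 1; omega)
      subst h9
      have h8' : 0 ≤ n2 := by
        by_contra! h10
        have := h.eq_of_rel h6 (h.down (n' := n2 + 1) h8 le_rfl le_rfl (by omega)) hK3 rfl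
          (by ring)
        omega
      have := h.eq_of_rel (h.down (n' := n' + (t + 1) + n2) (m' := 0)
        (m := 0) (n := if n' + (t + 1) + n2 ≤ 0 then -k else nz)
        (by split_ifs <;> [exact c.mem_k; exact c.mem_j]) le_rfl le_rfl (by
          have : n2 ≤ nz := by
            by_contra! h10
            exact c.notMem_j (h.down h8 le_rfl le_rfl (by omega))
          split_ifs <;> omega)) c.mem_k (h.sub hK2 hK3) (by ring) (by ring)
      omega
    have hi : m' = i := by
      apply le_antisymm
      · by_contra! H
        exact c.notMem_i (h.down h3 (by have := c.i_nonneg; omega) (by omega) (by omega))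
      · by_contra! H
        exact h5 (h.down c.mem_i (by omega) (by omega) (by omega))
    subst hi
    have := h.eq_of_rel (h.down (n' := -k - n') c.mem_k le_rfl le_rfl (by omega)) c.mem_x
      (h.sub c.rel_x hK2) (by ring) (by ring)
    right; omega

/-- Data forced by a descent on the right side of a tile. -/
theorem right_valley (h : IsTile r E K) (c : IsCorner E K i j k nx my ny mz nz) {m n : ℤ}
    (hn : 0 ≤ n) (h1 : E (m + 1) n) (h2 : E m (n + 1)) (h3 : ¬ E (m + 1) (n + 1)) :
    mz = m + 1 ∧ nz = n := by
  have hm := h.nonneg h2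
  obtain ⟨m', n', h4, hK⟩ := h.surj (m + 1) (n + 1)
  have hn' := h.nonpos_of_right h1 h3 h4 hK
  have h5 : m' = 0 := by
    by_contra h10
    have := h.nonneg h4
    obtain ⟨e2, e3⟩ := h.eq_of_rel h2
      (h.down (n' := n') h4 (m' := m' - 1) (by omega) (by omega) (by omega)) hK (by ring) rfl
    omega
  subst h5
  have e := h.eq_left_end c.k_nonneg c.mem_k c.notMem_k hn' h4
    (h.notMem_pred_right h1 h3 h4 hK)
  subst e
  have := h.eq_of_rel c.mem_z h1 (h.neg (h.add hK c.rel_z)) (by ring) (by ring)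
  exact this

/-- A tile with descents on both sides. -/
theorem two_valleys (h : IsTile r E K) (c : IsCorner E K i j k nx my ny mz nz) {m n m₁ n₁ : ℤ}
    (hn : 0 ≤ n) (h1 : E (m + 1) n) (h2 : E m (n + 1)) (h3 : ¬ E (m + 1) (n + 1))
    (hn₁ : 0 ≤ n₁) (g1 : E (m₁ + 1) (-n₁)) (g2 : E m₁ (-(n₁ + 1)))
    (g3 : ¬ E (m₁ + 1) (-(n₁ + 1))) :
    ∃ t : ℕ, i + 1 = my + mz ∧ -max nx 0 = 1 - (j - nz) + t ∧
      -max (-nx) 0 = 1 - (k + ny) + t := by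
  obtain ⟨rfl, rfl⟩ := h.right_valley c hn h1 h2 h3
  obtain ⟨rfl, g⟩ := h.swap.right_valley c.swap hn₁ g1 g2 g3
  have hm := h.nonneg h2
  have hm₁ := h.nonneg g2
  subst g
  have hmj : E m j := by
    obtain ⟨q, hq0, -, hq, hq'⟩ := exists_last (P := fun t => E t j) (N := i + 1) c.mem_j
      (by have := c.i_nonneg; omega)
      (fun H => c.notMem_i (h.down H (by have := c.i_nonneg; omega) le_rfl
        (by have := c.j_nonneg; omega)))
    by_cases hqm : m ≤ q
    · exact h.down hq hm hqm (by have := c.j_nonneg; omega)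
    · obtain ⟨t, ht0, htn, h6, h7⟩ := exists_last (P := fun t => E (q + 1) t) (N := j)
        (h.down h1 (by omega) (by omega) (by omega)) c.j_nonneg hq'
      have := h.right_valley c ht0 h6 (h.down hq hq0 le_rfl (by omega)) h7
      omega
  have hnj : ¬ ∃ t, E t (j + 1) := fun ⟨t, H⟩ => c.notMem_j (h.down H le_rfl (h.nonneg H)
    (by have := c.j_nonneg; omega))
  have hny := h.ny_nonpos c
  have hjn : nz + 1 ≤ j := by
    by_contra! H
    exact c.notMem_j (h.down h2 le_rfl hm (by have := c.j_nonneg; omega))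
  have hkn : -ny + 1 ≤ k := by
    by_contra! H
    exact c.notMem_k (h.down g2 le_rfl hm₁ (by have := c.k_nonneg; omega))
  have htop : E (m₁ + 1 + m) ny := by
    obtain ⟨m', n', h4, hK⟩ := h.surj m (j + 1)
    rcases h.right_jump c c.j_nonneg hmj (fun H => hnj ⟨_, H⟩) h4 hK with
      ⟨e1, -, rfl⟩ | ⟨e1, e2, -⟩
    · convert h4 using 1; omega
    · omega
  have htop' : ¬ E (m₁ + 1 + m + 1) 0 := by
    intro H
    have key : K (m₁ + 1 + (m + 1)) (nz - j + k + ny) := by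
      convert h.neg (h.add c.rel_y c.rel_z) using 1 <;> ring
    have := h.eq_of_rel (h.down (m' := 0) (n' := j - nz - k - ny)
        (m := 0) (n := if j - nz - k - ny ≤ 0 then -k else j)
        (by split_ifs <;> [exact c.mem_k; exact c.mem_j]) le_rfl le_rfl
        (by split_ifs <;> omega)) H (h.neg key) (by ring) (by ring)
    omega
  have hi : i = m₁ + 1 + m := by
    apply le_antisymm
    · by_contra! H
      exact htop' (h.down c.mem_i (by omega) (by omega) (by omega))
    · by_contra! H
      exact c.notMem_i (h.down htop (by have := c.i_nonneg; omega) (by omega) (by omega))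
  subst hi
  have hx : nx = j - nz - k - ny := by
    have key : K (m₁ + 1 + (m + 1)) (nz - j + k + ny) := by
      convert h.neg (h.add c.rel_y c.rel_z) using 1 <;> ring
    have := h.eq_of_rel (h.down (m' := 0) (n' := j - nz - k - ny)
        (m := 0) (n := if j - nz - k - ny ≤ 0 then -k else j)
        (by split_ifs <;> [exact c.mem_k; exact c.mem_j]) le_rfl le_rfl
        (by split_ifs <;> omega)) c.mem_x (h.sub c.rel_x key) (by ring) (by ring)
    omega
  refine ⟨(min (j - nz) (k + ny) - 1).toNat, by ring, ?_, ?_⟩ <;> omega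

end corner

end IsTile

theorem mem_of_add {N : AddSubmonoid Z3} {x y z x₁ y₁ z₁ x₂ y₂ z₂ : ℤ} (h1 : (x₁, y₁, z₁) ∈ N)
    (h2 : (x₂, y₂, z₂) ∈ N) (hx : x = x₁ + x₂) (hy : y = y₁ + y₂) (hz : z = z₁ + z₂) :
    (x, y, z) ∈ N := by
  subst hx hy hz
  exact N.add_mem h1 h2

theorem mem_of_eq {N : AddSubmonoid Z3} {x y z x₁ y₁ z₁ : ℤ} (h1 : (x₁, y₁, z₁) ∈ N)
    (hx : x = x₁) (hy : y = y₁) (hz : z = z₁) : (x, y, z) ∈ N := by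
  subst hx hy hz
  exact h1

/-- The vector of `ℤ³` joining the monomials which two planar points stand for. -/
def planarDiff (m n m' n' : ℤ) : Z3 :=
  (m - m', max n 0 - max n' 0, max (-n) 0 - max (-n') 0)

/-- The monoid generated by `(0, 1, 1)` and by the differences between monomials and their
representatives in a tile. -/
def tileMonoid (E K : ℤ → ℤ → Prop) : AddSubmonoid Z3 :=
  AddSubmonoid.closure (insert (0, 1, 1) { u | ∃ m n m' n' : ℤ,
    0 ≤ m ∧ E m' n' ∧ K (m - m') (n - n') ∧ u = planarDiff m n m' n' })

/-- Interchanging the last two coordinates. -/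
def swapHom : Z3 →+ Z3 where
  toFun u := (u.1, u.2.2, u.2.1)
  map_zero' := rfl
  map_add' _ _ := rfl

theorem planarDiff_mem_tileMonoid {E K : ℤ → ℤ → Prop} {m m' n n' : ℤ} (hm : 0 ≤ m)
    (h1 : E m' n') (h2 : K (m - m') (n - n')) : planarDiff m n m' n' ∈ tileMonoid E K :=
  AddSubmonoid.subset_closure (Or.inr ⟨m, n, m', n', hm, h1, h2, rfl⟩)

/-- The difference between `(m, n)` and its representative lies in `N`. -/
def DiffMem (E K : ℤ → ℤ → Prop) (N : AddSubmonoid Z3) (m n : ℤ) : Prop :=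
  ∀ m' n', E m' n' → K (m - m') (n - n') → planarDiff m n m' n' ∈ N

namespace IsTile

variable {r : ℤ} {E K : ℤ → ℤ → Prop} {i j k nx my ny mz nz : ℤ}

theorem diffMem_right (h : IsTile r E K) (c : IsCorner E K i j k nx my ny mz nz)
    {N : AddSubmonoid Z3} (hV : (0, 1, 1) ∈ N) (hY : (-my, j + 1, ny) ∈ N)
    (hZ : (mz, nz + 1, -k) ∈ N) {m n : ℤ} (hn : 0 ≤ n) (hD : DiffMem E K N m n) :
    DiffMem E K N m (n + 1) := by
  intro m' n' h1 hK
  obtain ⟨m₁, n₁, h2, hK₁⟩ := h.surj m n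
  have hD' := hD m₁ n₁ h2 hK₁
  have hK' : K (m₁ - m') (n₁ + 1 - n') := by convert h.sub hK hK₁ using 1 <;> ring
  have hny := h.ny_nonpos c
  have hnz := h.nz_nonneg c
  have hk := c.k_nonneg
  have hj := c.j_nonneg
  unfold planarDiff at *
  by_cases h3 : E m₁ (n₁ + 1)
  · obtain ⟨e1, e2⟩ := h.inj h3 h1 hK'
    rcases lt_or_ge n₁ 0 with h4 | h4
    · exact mem_of_add hD' hV (by omega) (by omega) (by omega)
    · exact mem_of_eq hD' (by omega) (by omega) (by omega)
  · have h4 : 0 ≤ n₁ := by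
      by_contra! h4
      exact h3 (h.down h2 (h.nonneg h2) le_rfl (by omega))
    rcases h.right_jump c h4 h2 h3 h1 hK' with h5 | h5
    · exact mem_of_add hD' hY (by omega) (by omega) (by omega)
    · exact mem_of_add hD' hZ (by omega) (by omega) (by omega)

theorem diffMem_left (h : IsTile r E K) (c : IsCorner E K i j k nx my ny mz nz)
    {N : AddSubmonoid Z3} (hV : (0, 1, 1) ∈ N) (hZ : (-mz, -nz, k + 1) ∈ N)
    (hY : (my, -j, 1 - ny) ∈ N) {m n : ℤ} (hn : n ≤ 0) (hD : DiffMem E K N m n) :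
    DiffMem E K N m (n - 1) := by
  have key : DiffMem (fun m n => E m (-n)) (fun x y => K x (-y)) (N.comap swapHom) m (-n + 1) := by
    refine h.swap.diffMem_right c.swap (N := N.comap swapHom) hV ?_ ?_ (by omega) ?_
    · exact mem_of_eq hZ rfl rfl rfl
    · exact mem_of_eq hY rfl (by ring) rfl
    · intro m' n' h1 hK
      have := hD m' (-n') h1 (by convert hK using 1; ring)
      exact mem_of_eq this rfl (by simp) (by simp)
  intro m' n' h1 hK
  have := key m' (-n') (by simpa using h1) (by convert hK using 1; ring)
  have h2 : (m - m', max (-(-n + 1)) 0 - max (- -n') 0, max (-n + 1) 0 - max (-n') 0) ∈ N := this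
  exact mem_of_eq h2 rfl (by omega) (by omega)

theorem tileMonoid_le (h : IsTile r E K) (c : IsCorner E K i j k nx my ny mz nz)
    {N : AddSubmonoid Z3} (hV : (0, 1, 1) ∈ N)
    (hX : (i + 1, -max nx 0, -max (-nx) 0) ∈ N)
    (hY : (-my, j + 1, ny) ∈ N) (hY' : (my, -j, 1 - ny) ∈ N)
    (hZ : (-mz, -nz, k + 1) ∈ N) (hZ' : (mz, nz + 1, -k) ∈ N) : tileMonoid E K ≤ N := by
  have column : ∀ m, DiffMem E K N m 0 → ∀ n, DiffMem E K N m n := by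
    intro m h0 n
    induction n using Int.induction_on with
    | zero => exact h0
    | succ n ih => exact h.diffMem_right c hV hY hZ' (by omega) ih
    | pred n ih => exact h.diffMem_left c hV hZ hY' (by omega) ih
  have inside : ∀ m n, E m n → DiffMem E K N m n := by
    intro m n h1 m' n' h2 hK
    obtain ⟨rfl, rfl⟩ := h.inj h1 h2 hK
    exact mem_of_eq (N.zero_mem : (0, 0, 0) ∈ N) (by simp) (by simp) (by simp)
  have low : ∀ m, 0 ≤ m → m ≤ i + 1 → DiffMem E K N m 0 := by
    intro m h0 h1
    rcases h1.lt_or_eq with h2 | rfl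
    · exact inside m 0 (h.down c.mem_i h0 (by omega) (by omega))
    · intro m' n' h3 hK
      obtain ⟨e1, e2⟩ := h.eq_of_rel h3 c.mem_x (h.sub c.rel_x hK) (by ring) (by ring)
      subst e1 e2
      exact mem_of_eq hX (by simp) (by simp) (by simp)
  have row : ∀ m, 0 ≤ m → DiffMem E K N m 0 := by
    intro m hm
    induction m, hm using Int.leInduction with
    | base => exact low 0 le_rfl (by have := c.i_nonneg; omega)
    | succ m hm ih =>
      intro m' n' h1 hK
      obtain ⟨m₁, n₁, h2, hK₁⟩ := h.surj m 0
      have hm₁ := h.nonneg h2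
      have hi : m₁ ≤ i := by
        by_contra! H
        exact c.notMem_i (h.down h2 (by have := c.i_nonneg; omega) (by omega) (by omega))
      have := column (m₁ + 1) (low (m₁ + 1) (by omega) (by omega)) n₁ m' n' h1
        (by convert h.sub hK hK₁ using 1 <;> ring)
      exact mem_of_add (ih m₁ n₁ h2 hK₁) this (by ring) (by ring) (by ring)
  refine (AddSubmonoid.closure_le).2 ?_
  rintro u (rfl | ⟨m, n, m', n', hm, h1, hK, rfl⟩)
  · exact hV
  · exact column m (row m hm) n m' n' h1 hK

end IsTile

/-- Three vectors spanning a lattice which contains a multiple of `ℤ³` are independent. -/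
theorem eq_zero_of_spanning {M : Set Z3} {R : ℤ} (hR : R ≠ 0) (h1 : (R, 0, 0) ∈ M)
    (h2 : (0, R, 0) ∈ M) (h3 : (0, 0, R) ∈ M) {e₁ e₂ e₃ : Z3}
    (hM : ∀ u ∈ M, ∃ x y z : ℤ, u = x • e₁ + y • e₂ + z • e₃) {x y z : ℤ}
    (h0 : x • e₁ + y • e₂ + z • e₃ = 0) : x = 0 ∧ y = 0 ∧ z = 0 := by
  obtain ⟨a₁, a₂, a₃⟩ := e₁
  obtain ⟨b₁, b₂, b₃⟩ := e₂
  obtain ⟨c₁, c₂, c₃⟩ := e₃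
  obtain ⟨x₁, y₁, z₁, g1⟩ := hM _ h1
  obtain ⟨x₂, y₂, z₂, g2⟩ := hM _ h2
  obtain ⟨x₃, y₃, z₃, g3⟩ := hM _ h3
  simp only [Prod.smul_mk, smul_eq_mul, Prod.mk_add_mk, Prod.mk.injEq, Prod.mk_eq_zero]
    at g1 g2 g3 h0
  let B : Matrix (Fin 3) (Fin 3) ℤ := !![a₁, a₂, a₃; b₁, b₂, b₃; c₁, c₂, c₃]
  let C : Matrix (Fin 3) (Fin 3) ℤ := !![x₁, y₁, z₁; x₂, y₂, z₂; x₃, y₃, z₃]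
  have hCB : C * B = R • (1 : Matrix (Fin 3) (Fin 3) ℤ) := by
    ext p q
    fin_cases p <;> fin_cases q <;>
      simp [C, B, Matrix.mul_apply, Fin.sum_univ_three] <;> linarith
  have hdet : B.det ≠ 0 := by
    intro hB
    have := congrArg Matrix.det hCB
    rw [Matrix.det_mul, hB, mul_zero, Matrix.det_smul, Matrix.det_one, mul_one] at this
    exact pow_ne_zero _ hR this.symm
  have hv : Matrix.vecMul ![x, y, z] B = 0 := by
    ext q
    fin_cases q <;> simp [B, Matrix.vecMul, dotProduct, Fin.sum_univ_three] <;> linarith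
  have := Matrix.eq_zero_of_vecMul_eq_zero hdet hv
  exact ⟨congrFun this 0, congrFun this 1, congrFun this 2⟩

theorem mem_closure_three {e₁ e₂ e₃ u : Z3} (hu : u ∈ AddSubmonoid.closure {e₁, e₂, e₃}) :
    ∃ x y z : ℕ, u = x • e₁ + y • e₂ + z • e₃ := by
  rw [Set.insert_eq, AddSubmonoid.closure_union, AddSubmonoid.mem_sup] at hu
  obtain ⟨v, hv, w, hw, rfl⟩ := hu
  obtain ⟨x, rfl⟩ := AddSubmonoid.mem_closure_singleton.1 hv
  obtain ⟨y, z, rfl⟩ := (AddSubmonoid.mem_closure_pair _ _ _).1 hw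
  exact ⟨x, y, z, (add_assoc _ _ _).symm⟩

/-- A monoid generated by a basis of a lattice is saturated. -/
theorem saturated_of_three {M : Set Z3} {N : AddSubmonoid Z3} {R : ℤ} (hR : R ≠ 0)
    (h1 : (R, 0, 0) ∈ M) (h2 : (0, R, 0) ∈ M) (h3 : (0, 0, R) ∈ M)
    (hM : ∀ u ∈ M, ∃ s ∈ N, ∃ t ∈ N, u = s - t) {e₁ e₂ e₃ : Z3}
    (m₁ : e₁ ∈ N) (m₂ : e₂ ∈ N) (m₃ : e₃ ∈ N)
    (hN : ∀ u ∈ N, ∃ x y z : ℕ, u = x • e₁ + y • e₂ + z • e₃)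
    {u : Z3} (hu : u ∈ M) {n : ℕ} (hn : 1 ≤ n) (hnu : n • u ∈ N) : u ∈ N := by
  have hM' : ∀ u ∈ M, ∃ x y z : ℤ, u = x • e₁ + y • e₂ + z • e₃ := by
    intro u hu
    obtain ⟨s, hs, t, ht, rfl⟩ := hM u hu
    obtain ⟨x, y, z, rfl⟩ := hN s hs
    obtain ⟨x', y', z', rfl⟩ := hN t ht
    exact ⟨x - x', y - y', z - z', by module⟩
  obtain ⟨x, y, z, g⟩ := hN _ hnu
  obtain ⟨x', y', z', rfl⟩ := hM' u hu
  have := eq_zero_of_spanning hR h1 h2 h3 hM' (x := n * x' - x) (y := n * y' - y)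
    (z := n * z' - z) (by rw [← sub_eq_zero] at g; rw [← g]; module)
  have hn' : (0 : ℤ) < n := by exact_mod_cast hn
  lift x' to ℕ using by by_contra! H; nlinarith [mul_neg_of_pos_of_neg hn' H]
  lift y' to ℕ using by by_contra! H; nlinarith [mul_neg_of_pos_of_neg hn' H]
  lift z' to ℕ using by by_contra! H; nlinarith [mul_neg_of_pos_of_neg hn' H]
  simp only [natCast_zsmul]
  exact N.add_mem (N.add_mem (N.nsmul_mem m₁ _) (N.nsmul_mem m₂ _)) (N.nsmul_mem m₃ _)

/-- A monoid generated by four vectors, spanning a lattice of rank three and satisfying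
`e₁ + e₂ = e₃ + e₄`, is saturated. -/
theorem saturated_of_four {M : Set Z3} {N : AddSubmonoid Z3} {R : ℤ} (hR : R ≠ 0)
    (h1 : (R, 0, 0) ∈ M) (h2 : (0, R, 0) ∈ M) (h3 : (0, 0, R) ∈ M)
    (hM : ∀ u ∈ M, ∃ s ∈ N, ∃ t ∈ N, u = s - t) {e₁ e₂ e₃ e₄ : Z3}
    (m₁ : e₁ ∈ N) (m₂ : e₂ ∈ N) (m₃ : e₃ ∈ N) (m₄ : e₄ ∈ N) (he : e₄ = e₁ + e₂ - e₃)
    (hN : ∀ u ∈ N, ∃ x y z w : ℕ, u = x • e₁ + y • e₂ + z • e₃ + w • e₄)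
    {u : Z3} (hu : u ∈ M) {n : ℕ} (hn : 1 ≤ n) (hnu : n • u ∈ N) : u ∈ N := by
  have hM' : ∀ u ∈ M, ∃ x y z : ℤ, u = x • e₁ + y • e₂ + z • e₃ := by
    intro u hu
    obtain ⟨s, hs, t, ht, rfl⟩ := hM u hu
    obtain ⟨x, y, z, w, rfl⟩ := hN s hs
    obtain ⟨x', y', z', w', rfl⟩ := hN t ht
    exact ⟨x + w - (x' + w'), y + w - (y' + w'), z - w - (z' - w'), by rw [he]; module⟩
  obtain ⟨x, y, z, w, g⟩ := hN _ hnu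
  obtain ⟨x', y', z', rfl⟩ := hM' u hu
  obtain ⟨gx, gy, gz⟩ := eq_zero_of_spanning hR h1 h2 h3 hM' (x := n * x' - (x + w))
    (y := n * y' - (y + w)) (z := n * z' - (z - w))
    (by rw [← sub_eq_zero] at g; rw [← g, he]; module)
  have hn' : (0 : ℤ) < n := by exact_mod_cast hn
  have hx : 0 ≤ x' := by by_contra! H; nlinarith [mul_neg_of_pos_of_neg hn' H]
  have hy : 0 ≤ y' := by by_contra! H; nlinarith [mul_neg_of_pos_of_neg hn' H]
  have hxz : 0 ≤ x' + z' := by by_contra! H; nlinarith [mul_neg_of_pos_of_neg hn' H]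
  have hyz : 0 ≤ y' + z' := by by_contra! H; nlinarith [mul_neg_of_pos_of_neg hn' H]
  have zsmul_mem : ∀ (t : ℤ) (e : Z3), 0 ≤ t → e ∈ N → t • e ∈ N := by
    intro t e ht hN
    lift t to ℕ using ht
    simpa using N.nsmul_mem hN t
  rcases le_total 0 z' with hz | hz
  · exact N.add_mem (N.add_mem (zsmul_mem _ _ hx m₁) (zsmul_mem _ _ hy m₂)) (zsmul_mem _ _ hz m₃)
  · have : x' • e₁ + y' • e₂ + z' • e₃ = (x' + z') • e₁ + (y' + z') • e₂ + (-z') • e₄ := by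
      rw [he]; module
    rw [this]
    exact N.add_mem (N.add_mem (zsmul_mem _ _ hxz m₁) (zsmul_mem _ _ hyz m₂))
      (zsmul_mem _ _ (by omega) m₄)

theorem IsTile.saturated {r : ℤ} {E K : ℤ → ℤ → Prop} (h : IsTile r E K) {u : Z3}
    (hu : K u.1 (u.2.1 - u.2.2)) {n : ℕ} (hn : 1 ≤ n) (hnu : n • u ∈ tileMonoid E K) :
    u ∈ tileMonoid E K := by
  obtain ⟨i, j, k, nx, my, ny, mz, nz, c⟩ := h.exists_corner
  have hny := h.ny_nonpos c
  have hnz := h.nz_nonneg c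
  have hi := c.i_nonneg
  have hj := c.j_nonneg
  have hk := c.k_nonneg
  have hV : ((0, 1, 1) : Z3) ∈ tileMonoid E K := AddSubmonoid.subset_closure (Or.inl rfl)
  have hX : (i + 1, -max nx 0, -max (-nx) 0) ∈ tileMonoid E K :=
    mem_of_eq (planarDiff_mem_tileMonoid (m := i + 1) (n := 0) (by omega) c.mem_x
      (by simpa using c.rel_x)) (by simp) (by simp) (by simp)
  have hY : (-my, j + 1, ny) ∈ tileMonoid E K :=
    mem_of_eq (planarDiff_mem_tileMonoid (m := 0) (n := j + 1) le_rfl c.mem_y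
      (by simpa using c.rel_y)) (by omega) (by omega) (by omega)
  have hZ : (-mz, -nz, k + 1) ∈ tileMonoid E K :=
    mem_of_eq (planarDiff_mem_tileMonoid (m := 0) (n := -k - 1) le_rfl c.mem_z
      (by simpa using c.rel_z)) (by omega) (by omega) (by omega)
  have hY' : (my, -j, 1 - ny) ∈ tileMonoid E K :=
    mem_of_eq (planarDiff_mem_tileMonoid (m := my) (n := ny - 1) (h.nonneg c.mem_y) c.mem_j
      (by convert h.neg c.rel_y using 1 <;> ring)) (by omega) (by omega) (by omega)
  have hZ' : (mz, nz + 1, -k) ∈ tileMonoid E K :=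
    mem_of_eq (planarDiff_mem_tileMonoid (m := mz) (n := nz + 1) (h.nonneg c.mem_z) c.mem_k
      (by convert h.neg c.rel_z using 1 <;> ring)) (by omega) (by omega) (by omega)
  have hM : ∀ u ∈ {u : Z3 | K u.1 (u.2.1 - u.2.2)}, ∃ s ∈ tileMonoid E K,
      ∃ t ∈ tileMonoid E K, u = s - t := by
    rintro ⟨x, y, z⟩ hu
    obtain ⟨m', n', h1, hK⟩ := h.surj (max (-x) 0) 0
    refine ⟨_, (tileMonoid E K).add_mem (planarDiff_mem_tileMonoid (m := max x 0) (n := y - z)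
        (by omega) h1 ?_) ((tileMonoid E K).nsmul_mem hV (min y z).toNat), _,
      (tileMonoid E K).add_mem (planarDiff_mem_tileMonoid (m := max (-x) 0) (n := 0)
        (by omega) h1 hK) ((tileMonoid E K).nsmul_mem hV (-min y z).toNat), ?_⟩
    · convert h.add hK hu using 1
      · dsimp only; omega
      · dsimp only; omega
    · simp only [planarDiff, Prod.smul_mk, Prod.mk_add_mk, Prod.mk_sub_mk,
        Prod.mk.injEq, nsmul_eq_mul]
      refine ⟨?_, ?_, ?_⟩ <;> simp only [mul_zero, mul_one] <;> omega
  have h1 : ((r, 0, 0) : Z3) ∈ {u : Z3 | K u.1 (u.2.1 - u.2.2)} := by simpa using h.left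
  have h2 : ((0, r, 0) : Z3) ∈ {u : Z3 | K u.1 (u.2.1 - u.2.2)} := by simpa using h.right
  have h3 : ((0, 0, r) : Z3) ∈ {u : Z3 | K u.1 (u.2.1 - u.2.2)} := by simpa using h.neg h.right
  have smooth : ((my + mz = 0 ∧ j = nz ∧ k = -ny) ∨
      (i + 1 = my + mz ∧ j = nz + max nx 0 ∧ k = -ny + max (-nx) 0)) →
      u ∈ tileMonoid E K := by
    intro hcase
    refine saturated_of_three h.pos.ne' h1 h2 h3 hM hX hY hZ (fun v hv => ?_) hu hn hnu
    refine mem_closure_three (h.tileMonoid_le c ?_ ?_ ?_ ?_ ?_ ?_ hv)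
    all_goals
      have gX := AddSubmonoid.subset_closure (s := {(i + 1, -max nx 0, -max (-nx) 0),
        (-my, j + 1, ny), (-mz, -nz, k + 1)}) (Or.inl rfl)
      have gY := AddSubmonoid.subset_closure (s := {(i + 1, -max nx 0, -max (-nx) 0),
        (-my, j + 1, ny), (-mz, -nz, k + 1)}) (Or.inr (Or.inl rfl))
      have gZ := AddSubmonoid.subset_closure (s := {(i + 1, -max nx 0, -max (-nx) 0),
        (-my, j + 1, ny), (-mz, -nz, k + 1)}) (Or.inr (Or.inr rfl))
    · rcases hcase with hc | hc
      · exact mem_of_add gY gZ (by omega) (by omega) (by omega)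
      · exact mem_of_add (mem_of_add gX gY rfl rfl rfl) gZ (by omega) (by omega) (by omega)
    · exact gX
    · exact gY
    · rcases hcase with hc | hc
      · exact mem_of_eq gZ (by omega) (by omega) (by omega)
      · exact mem_of_add gX gZ (by omega) (by omega) (by omega)
    · exact gZ
    · rcases hcase with hc | hc
      · exact mem_of_eq gY (by omega) (by omega) (by omega)
      · exact mem_of_add gX gY (by omega) (by omega) (by omega)
  by_cases hr : ∀ m n, 0 ≤ n → E (m + 1) n → E m (n + 1) → E (m + 1) (n + 1)
  · exact smooth (h.no_right_valley c hr)
  by_cases hl : ∀ m n, 0 ≤ n → E (m + 1) (-n) → E m (-(n + 1)) → E (m + 1) (-(n + 1))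
  · have := h.swap.no_right_valley c.swap hl
    exact smooth (by rw [neg_neg] at this; omega)
  push Not at hr hl
  obtain ⟨p, q, hq, hr1, hr2, hr3⟩ := hr
  obtain ⟨p', q', hq', hl1, hl2, hl3⟩ := hl
  obtain ⟨t, ht1, ht2, ht3⟩ := h.two_valleys c hq hr1 hr2 hr3 hq' hl1 hl2 hl3
  refine saturated_of_four h.pos.ne' h1 h2 h3 hM hY hY' hZ hZ' ?_ (fun v hv => ?_) hu hn hnu
  · simp only [Prod.mk_add_mk, Prod.mk_sub_mk, Prod.mk.injEq]
    refine ⟨by ring, by ring, by ring⟩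
  let N : AddSubmonoid Z3 := AddSubmonoid.closure {(-my, j + 1, ny), (my, -j, 1 - ny),
    (-mz, -nz, k + 1)} ⊔ AddSubmonoid.closure {(mz, nz + 1, -k)}
  have gY : (-my, j + 1, ny) ∈ N :=
    (le_sup_left : _ ≤ N) (AddSubmonoid.subset_closure (Or.inl rfl))
  have gY' : (my, -j, 1 - ny) ∈ N :=
    (le_sup_left : _ ≤ N) (AddSubmonoid.subset_closure (Or.inr (Or.inl rfl)))
  have gZ : (-mz, -nz, k + 1) ∈ N :=
    (le_sup_left : _ ≤ N) (AddSubmonoid.subset_closure (Or.inr (Or.inr rfl)))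
  have gZ' : (mz, nz + 1, -k) ∈ N :=
    (le_sup_right : _ ≤ N) (AddSubmonoid.subset_closure rfl)
  have gV : ((0, 1, 1) : Z3) ∈ N := mem_of_add gY gY' (by ring) (by ring) (by ring)
  have gX : (i + 1, -max nx 0, -max (-nx) 0) ∈ N := by
    refine mem_of_add (N.add_mem gY' gZ') (N.nsmul_mem gV t) ?_ ?_ ?_
    · simp; omega
    · simp; omega
    · simp; omega
  obtain ⟨a, ha, b, hb, rfl⟩ := AddSubmonoid.mem_sup.1 (h.tileMonoid_le c gV gX gY gY' gZ gZ' hv)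
  obtain ⟨x, y, z, rfl⟩ := mem_closure_three ha
  obtain ⟨w, rfl⟩ := AddSubmonoid.mem_closure_singleton.1 hb
  exact ⟨x, y, z, w, rfl⟩

section

variable {r a : ℕ} {Γ : Set N3}

theorem wtZ_eq (har : a ≤ r) (u : Z3) :
    wtZ r a u = (u.1 : ZMod r) + a * ((u.2.1 - u.2.2 : ℤ) : ZMod r) := by
  simp only [wtZ, Nat.cast_sub har, ZMod.natCast_self, Int.cast_sub]
  ring

theorem wtZ_sub_eq_zero_iff (u v : Z3) : wtZ r a (u - v) = 0 ↔ wtZ r a u = wtZ r a v := by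
  rw [← sub_eq_zero (b := wtZ r a v)]
  simp only [wtZ, Prod.fst_sub, Prod.snd_sub, Int.cast_sub]
  ring_nf

theorem IsGSet.mem_of_le (hΓ : IsGSet r a Γ) {u v : N3} (hv : v ∈ Γ) (huv : u ≤ v) : u ∈ Γ := by
  have := hΓ.dclosed u (v - u) (by rwa [add_tsub_cancel_of_le huv])
  exact this.1

/-- No monomial of a `G`-set is divisible by `yz`. -/
theorem IsGSet.eq_zero_or (har : a ≤ r) (hΓ : IsGSet r a Γ) {u : N3} (hu : u ∈ Γ) :
    u.2.1 = 0 ∨ u.2.2 = 0 := by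
  by_contra! H
  have h1 : ((0, 1, 1) : N3) ∈ Γ := hΓ.mem_of_le hu
    ⟨Nat.zero_le _, Nat.one_le_iff_ne_zero.2 H.1, Nat.one_le_iff_ne_zero.2 H.2⟩
  have := hΓ.bij.injOn h1 hΓ.zero_mem (by simp [wtN, wtZ_eq har, toZ])
  simp at this

/-- The planar points of a `G`-set. -/
def PlanarMem (Γ : Set N3) (m n : ℤ) : Prop :=
  0 ≤ m ∧ (m.toNat, n.toNat, (-n).toNat) ∈ Γ

/-- The planar vectors of weight zero. -/
def PlanarRel (r a : ℕ) (x y : ℤ) : Prop := (x : ZMod r) + a * (y : ZMod r) = 0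

theorem planarRel_iff (har : a ≤ r) (u v : Z3) :
    PlanarRel r a (u.1 - v.1) (u.2.1 - u.2.2 - (v.2.1 - v.2.2)) ↔ wtZ r a u = wtZ r a v := by
  rw [← wtZ_sub_eq_zero_iff, wtZ_eq har, PlanarRel]
  congr! 4
  simp only [Prod.fst_sub, Prod.snd_sub]
  ring

theorem IsGSet.planarMem (har : a ≤ r) (hΓ : IsGSet r a Γ) {u : N3} (hu : u ∈ Γ) :
    PlanarMem Γ u.1 (u.2.1 - u.2.2) := by
  refine ⟨by omega, ?_⟩
  have := hΓ.eq_zero_or har hu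
  convert hu using 1
  ext <;> simp <;> omega

theorem IsGSet.isTile (hr : 0 < r) (har : a ≤ r) (hΓ : IsGSet r a Γ) :
    IsTile r (PlanarMem Γ) (PlanarRel r a) where
  pos := by exact_mod_cast hr
  zero := ⟨le_rfl, hΓ.zero_mem⟩
  nonneg h := h.1
  down := fun h h0 h1 h2 => ⟨h0, hΓ.mem_of_le h.2
    ⟨by dsimp only; omega, by dsimp only; omega, by dsimp only; omega⟩⟩
  inj := fun {m n m' n'} h1 h2 h3 => by
    have h1' := h1.1
    have h2' := h2.1
    have := hΓ.bij.injOn h1.2 h2.2 ((planarRel_iff har _ _).1 (by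
      convert h3 using 1 <;> simp only [toZ] <;> omega))
    simp only [Prod.mk.injEq] at this
    omega
  surj := fun m n => by
    obtain ⟨w, hw, hwt⟩ := hΓ.bij.surjOn (Set.mem_univ (wtZ r a (m, n, 0)))
    refine ⟨_, _, hΓ.planarMem har hw, ?_⟩
    simpa [toZ] using (planarRel_iff har (m, n, 0) (toZ w)).2 hwt.symm
  add := fun {x y x' y'} h1 h2 => by
    unfold PlanarRel at *
    push_cast
    linear_combination h1 + h2
  neg := fun {x y} h1 => by
    unfold PlanarRel at *
    push_cast
    linear_combination -h1
  left := by simp [PlanarRel]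
  right := by simp [PlanarRel]

theorem IsGSet.wtG_spec (hΓ : IsGSet r a Γ) (v : N3) :
    wtG r a Γ v ∈ Γ ∧ wtN r a (wtG r a Γ v) = wtN r a v := by
  have h : ∃ w, w ∈ Γ ∧ wtN r a w = wtN r a v := by
    obtain ⟨w, hw, h⟩ := hΓ.bij.surjOn (Set.mem_univ (wtN r a v))
    exact ⟨w, hw, h⟩
  rw [wtG, dif_pos h]
  exact h.choose_spec

theorem IsGSet.wtG_eq (hΓ : IsGSet r a Γ) {v w : N3} (hw : w ∈ Γ) (h : wtN r a w = wtN r a v) :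
    wtG r a Γ v = w :=
  hΓ.bij.injOn (hΓ.wtG_spec v).1 hw ((hΓ.wtG_spec v).2.trans h.symm)

theorem IsGSet.sMon_eq (har : a ≤ r) (hΓ : IsGSet r a Γ) :
    SMon r a Γ = tileMonoid (PlanarMem Γ) (PlanarRel r a) := by
  apply le_antisymm
  · refine (AddSubmonoid.closure_le).2 ?_
    rintro _ ⟨v, rfl⟩
    obtain ⟨hw, hwt⟩ := hΓ.wtG_spec v
    have h0 := hΓ.eq_zero_or har hw
    have h1 := planarDiff_mem_tileMonoid (m := v.1) (n := v.2.1 - v.2.2) (by omega)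
      (hΓ.planarMem har hw) ((planarRel_iff har (toZ v) (toZ (wtG r a Γ v))).2 hwt.symm)
    have hV : ((0, 1, 1) : Z3) ∈ tileMonoid (PlanarMem Γ) (PlanarRel r a) :=
      AddSubmonoid.subset_closure (Or.inl rfl)
    refine mem_of_add h1 (AddSubmonoid.nsmul_mem _ hV (min v.2.1 v.2.2)) ?_ ?_ ?_ <;>
      simp [toZ] <;> omega
  · refine (AddSubmonoid.closure_le).2 ?_
    rintro _ (rfl | ⟨m, n, m', n', hm, hw, hK, rfl⟩)
    · refine AddSubmonoid.subset_closure ⟨(0, 1, 1), ?_⟩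
      rw [sG, hΓ.wtG_eq hΓ.zero_mem (by simp [wtN, wtZ_eq har, toZ])]
      simp [toZ]
    · refine AddSubmonoid.subset_closure ⟨(m.toNat, n.toNat, (-n).toNat), ?_⟩
      have hm' := hw.1
      rw [sG, hΓ.wtG_eq hw.2 ((planarRel_iff har _ _).1 (by
        convert hK using 1 <;> simp only [toZ] <;> omega)).symm]
      simp only [toZ, planarDiff, Prod.mk_sub_mk, Prod.mk.injEq]
      omega

end

/-- `S(Γ)` is saturated in the lattice `M`. -/
theorem stmt9 (r a : ℕ) (hra : Nat.Coprime r a) (ha2 : 2 ≤ a) (halt : a < r - a) (Γ : Set N3) (hΓ : IsGSet r a Γ) :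
    ∀ u ∈ latM r a, ∀ n : ℕ, 1 ≤ n → n • u ∈ SMon r a Γ → u ∈ SMon r a Γ := by
  have har : a ≤ r := by omega
  intro u hu n hn hnu
  rw [hΓ.sMon_eq har] at hnu ⊢
  exact (hΓ.isTile (by omega) har).saturated ((wtZ_eq har u).symm.trans hu) hn hnu

end GH
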